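/- Induction step of the angle lemma: Let δ > 0 with δ ≤ arcsin(1/√n), and suppose v_1,...,v_{ℓ−1} ∈ S^{n−1} and an orthonormal basis {e_1,...,e_n} of ℝⁿ satisfy |⟨e_α, v_b⟩| ≥ sin δ for all α and all b ≤ ℓ−1. Then for any additional vector v_ℓ ∈ S^{n−1} there exists a rotation R ∈ SO(n) with new basis e'_α = R(e_α) such that |⟨e'_α, v_b⟩| ≥ sin(δ·(1/2)^{n−1}) for all α ∈ {1,...,n} and all b ∈ {1,...,ℓ}. -/

import Mathlib

open scoped RealInnerProductSpace

section Aux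

variable {E : Type*} [NormedAddCommGroup E] [InnerProductSpace ℝ E]

/-- The rotation with cosine `c` and sine `s` in the plane of `u`, `p`. -/
noncomputable def rotLin (u p : E) (c s : ℝ) : E →ₗ[ℝ] E where
  toFun x := x + ⟪u, x⟫ • ((c - 1) • u + s • p) + ⟪p, x⟫ • ((c - 1) • p - s • u)
  map_add' x y := by
    simp only [inner_add_right]
    module
  map_smul' r x := by
    simp only [inner_smul_right, RingHom.id_apply]
    module

lemma rotLin_apply (u p : E) (c s : ℝ) (x : E) : rotLin u p c s x =
    x + ⟪u, x⟫ • ((c - 1) • u + s • p) + ⟪p, x⟫ • ((c - 1) • p - s • u) := rfl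

lemma rot_comp (u p : E) (hu : ‖u‖ = 1) (hp : ‖p‖ = 1) (hup : ⟪u, p⟫ = 0)
    (c s : ℝ) :
    rotLin u p c s ∘ₗ rotLin u p c s = rotLin u p (c * c - s * s) (2 * s * c) := by
  have hpu : ⟪p, u⟫ = 0 := by rw [real_inner_comm]; exact hup
  have huu : ⟪u, u⟫ = 1 := by rw [real_inner_self_eq_norm_sq, hu]; norm_num
  have hpp : ⟪p, p⟫ = 1 := by rw [real_inner_self_eq_norm_sq, hp]; norm_num
  ext x
  simp only [LinearMap.comp_apply, rotLin_apply, inner_add_right, inner_sub_right,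
    inner_smul_right, hup, hpu, huu, hpp]
  module

lemma rot_norm (u p : E) (hu : ‖u‖ = 1) (hp : ‖p‖ = 1) (hup : ⟪u, p⟫ = 0)
    (c s : ℝ) (hcs : c ^ 2 + s ^ 2 = 1) (x : E) : ‖rotLin u p c s x‖ = ‖x‖ := by
  have hpu : ⟪p, u⟫ = 0 := by rw [real_inner_comm]; exact hup
  have huu : ⟪u, u⟫ = 1 := by rw [real_inner_self_eq_norm_sq, hu]; norm_num
  have hpp : ⟪p, p⟫ = 1 := by rw [real_inner_self_eq_norm_sq, hp]; norm_num
  have key : ‖rotLin u p c s x‖ ^ 2 = ‖x‖ ^ 2 := by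
    rw [← real_inner_self_eq_norm_sq, ← real_inner_self_eq_norm_sq]
    simp only [rotLin_apply, inner_add_right, inner_sub_right, inner_add_left, inner_sub_left,
      inner_smul_right, real_inner_smul_left, hup, hpu, huu, hpp,
      real_inner_comm u x, real_inner_comm p x]
    linear_combination (⟪u, x⟫ ^ 2 + ⟪p, x⟫ ^ 2) * hcs
  exact (sq_eq_sq₀ (norm_nonneg _) (norm_nonneg _)).1 key

lemma bessel_two (u p : E) (hu : ‖u‖ = 1) (hp : ‖p‖ = 1) (hup : ⟪u, p⟫ = 0)
    (x : E) : ⟪u, x⟫ ^ 2 + ⟪p, x⟫ ^ 2 ≤ ‖x‖ ^ 2 := by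
  have hpu : ⟪p, u⟫ = 0 := by rw [real_inner_comm]; exact hup
  have huu : ⟪u, u⟫ = 1 := by rw [real_inner_self_eq_norm_sq, hu]; norm_num
  have hpp : ⟪p, p⟫ = 1 := by rw [real_inner_self_eq_norm_sq, hp]; norm_num
  have h : 0 ≤ ⟪x - ⟪u, x⟫ • u - ⟪p, x⟫ • p, x - ⟪u, x⟫ • u - ⟪p, x⟫ • p⟫ :=
    real_inner_self_nonneg
  rw [← real_inner_self_eq_norm_sq]
  simp only [inner_sub_right, inner_sub_left,
      inner_smul_right, real_inner_smul_left, hup, hpu, huu, hpp,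
      real_inner_comm u x, real_inner_comm p x] at h
  nlinarith

/-- One rotation by `θ` moving `u` away from the hyperplane orthogonal to `w`. -/
lemma exists_rot [FiniteDimensional ℝ E] (u w : E) (hu : ‖u‖ = 1) (hw : ‖w‖ = 1) (θ : ℝ)
    (h0 : 0 ≤ θ) (h4 : θ ≤ Real.pi / 4) (huw : |⟪u, w⟫| < Real.sin θ) :
    ∃ R : E ≃ₗᵢ[ℝ] E, 0 < LinearMap.det (R.toLinearEquiv.toLinearMap) ∧
      (∀ x, ‖x‖ = 1 → Real.cos θ ≤ ⟪x, R x⟫) ∧ Real.sin θ ≤ |⟪R u, w⟫| := by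
  wlog ha : 0 ≤ ⟪u, w⟫ generalizing w
  · obtain ⟨R, h1, h2, h3⟩ := this (-w) (by simpa using hw) (by simpa using huw)
      (by rw [inner_neg_right]; linarith)
    exact ⟨R, h1, h2, by simpa using h3⟩
  set a := ⟪u, w⟫ with hadef
  have huu : ⟪u, u⟫ = 1 := by rw [real_inner_self_eq_norm_sq, hu]; norm_num
  have hww : ⟪w, w⟫ = 1 := by rw [real_inner_self_eq_norm_sq, hw]; norm_num
  rw [abs_of_nonneg ha] at huw
  have hs0 : 0 ≤ Real.sin θ := ha.trans huw.le
  have ha1 : a < 1 := huw.trans_le (Real.sin_le_one _)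
  have hpi := Real.pi_pos
  have hc0 : 0 ≤ Real.cos θ := Real.cos_nonneg_of_mem_Icc ⟨by linarith, by linarith⟩
  have hsc : Real.sin θ ≤ Real.cos θ := by
    rw [← Real.sin_pi_div_two_sub]
    exact Real.sin_le_sin_of_le_of_le_pi_div_two (by linarith) (by linarith) (by linarith)
  set q := w - a • u with hq
  have hqq : ‖q‖ ^ 2 = 1 - a ^ 2 := by
    rw [← real_inner_self_eq_norm_sq, hq]
    simp only [inner_sub_right, inner_sub_left, inner_smul_right, real_inner_smul_left, huu, hww,
      real_inner_comm u w, ← hadef]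
    ring
  have huq : ⟪u, q⟫ = 0 := by
    rw [hq, inner_sub_right, inner_smul_right, huu, ← hadef]; ring
  have hq0 : 0 < ‖q‖ := by
    by_contra hh
    have : ‖q‖ = 0 := le_antisymm (not_lt.1 hh) (norm_nonneg _)
    rw [this] at hqq
    nlinarith
  set p := ‖q‖⁻¹ • q with hpdef
  have hp : ‖p‖ = 1 := by
    rw [hpdef, norm_smul, norm_inv, norm_norm, inv_mul_cancel₀ hq0.ne']
  have hup : ⟪u, p⟫ = 0 := by rw [hpdef, inner_smul_right, huq, mul_zero]
  have hpw : ⟪p, w⟫ = ‖q‖ := by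
    have : w = q + a • u := by rw [hq]; abel
    rw [this, hpdef, real_inner_smul_left, inner_add_right, inner_smul_right,
      real_inner_comm u q, huq, real_inner_self_eq_norm_sq]
    field_simp
    ring
  let S : E →ₗᵢ[ℝ] E := ⟨rotLin u p (Real.cos θ) (Real.sin θ),
    rot_norm u p hu hp hup _ _ (Real.cos_sq_add_sin_sq θ)⟩
  let R : E ≃ₗᵢ[ℝ] E := S.toLinearIsometryEquiv rfl
  have hR : ∀ x, R x = rotLin u p (Real.cos θ) (Real.sin θ) x := fun x => rfl
  have hRl : R.toLinearEquiv.toLinearMap = rotLin u p (Real.cos θ) (Real.sin θ) := by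
    ext x; rfl
  refine ⟨R, ?_, ?_, ?_⟩
  · have hne : LinearMap.det (R.toLinearEquiv.toLinearMap) ≠ 0 :=
      (LinearEquiv.isUnit_det' R.toLinearEquiv).ne_zero
    have hsq : R.toLinearEquiv.toLinearMap =
        rotLin u p (Real.cos (θ / 2)) (Real.sin (θ / 2)) ∘ₗ
          rotLin u p (Real.cos (θ / 2)) (Real.sin (θ / 2)) := by
      rw [hRl, rot_comp u p hu hp hup]
      congr 1
      · conv_lhs => rw [show θ = θ / 2 + θ / 2 by ring, Real.cos_add]
      · conv_lhs => rw [show θ = 2 * (θ / 2) by ring, Real.sin_two_mul]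
    rw [hsq, LinearMap.det_comp] at hne ⊢
    exact lt_of_le_of_ne (mul_self_nonneg _) hne.symm
  · intro x hx
    have hb := bessel_two u p hu hp hup x
    have hxx : ⟪x, x⟫ = 1 := by rw [real_inner_self_eq_norm_sq, hx]; norm_num
    rw [hx] at hb
    have : ⟪x, R x⟫ = 1 + (Real.cos θ - 1) * (⟪u, x⟫ ^ 2 + ⟪p, x⟫ ^ 2) := by
      rw [hR, rotLin_apply]
      simp only [inner_add_right, inner_sub_right, inner_smul_right, hxx,
        real_inner_comm u x, real_inner_comm p x]
      ring
    rw [this]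
    nlinarith [Real.cos_le_one θ]
  · have : ⟪R u, w⟫ = Real.cos θ * a + Real.sin θ * ‖q‖ := by
      rw [hR, rotLin_apply]
      simp only [huu, real_inner_comm u p, hup, inner_add_left, real_inner_smul_left, hpw,
        ← hadef]
      ring
    rw [this]
    refine le_trans ?_ (le_abs_self _)
    have hq1 : ‖q‖ ≤ 1 := by nlinarith
    have h1 : 1 - ‖q‖ ≤ a := by nlinarith
    nlinarith [mul_le_mul_of_nonneg_left h1 hs0, mul_le_mul_of_nonneg_right hsc ha]

/-- Moving a unit vector by angle at most `θ` costs at most `θ`. -/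
lemma perturb (x y v : E) (hx : ‖x‖ = 1) (hy : ‖y‖ = 1) (hv : ‖v‖ = 1) (θ : ℝ)
    (h0 : 0 ≤ θ) (h4 : θ ≤ Real.pi / 4) (hxy : Real.cos θ ≤ ⟪x, y⟫)
    (h : Real.sin (2 * θ) ≤ |⟪x, v⟫|) : Real.sin θ ≤ |⟪y, v⟫| := by
  wlog ha : 0 ≤ ⟪x, v⟫ generalizing v
  · have := this (-v) (by simpa using hv) (by simpa using h)
      (by rw [inner_neg_right]; linarith)
    simpa using this
  rw [abs_of_nonneg ha] at h
  have hpi := Real.pi_pos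
  have cosang : ∀ a b : E, ‖a‖ = 1 → ‖b‖ = 1 →
      Real.cos (InnerProductGeometry.angle a b) = ⟪a, b⟫ := by
    intro a b h1 h2
    rw [InnerProductGeometry.cos_angle, h1, h2]; simp
  have h1 : InnerProductGeometry.angle x y ≤ θ := by
    by_contra hh
    have := Real.cos_lt_cos_of_nonneg_of_le_pi h0 (InnerProductGeometry.angle_le_pi x y)
      (not_le.1 hh)
    rw [cosang x y hx hy] at this
    linarith
  have h2 : InnerProductGeometry.angle x v ≤ Real.pi / 2 - 2 * θ := by
    by_contra hh
    have := Real.cos_lt_cos_of_nonneg_of_le_pi (by linarith)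
      (InnerProductGeometry.angle_le_pi x v) (not_le.1 hh)
    rw [cosang x v hx hv, Real.cos_pi_div_two_sub] at this
    linarith
  have h3 := InnerProductGeometry.angle_le_angle_add_angle y x v
  rw [InnerProductGeometry.angle_comm y x] at h3
  have h5 : Real.cos (Real.pi / 2 - θ) ≤ Real.cos (InnerProductGeometry.angle y v) :=
    Real.cos_le_cos_of_nonneg_of_le_pi (InnerProductGeometry.angle_nonneg y v)
      (by linarith) (by linarith)
  rw [Real.cos_pi_div_two_sub, cosang y v hy hv] at h5
  exact h5.trans (le_abs_self _)

lemma main_ind [FiniteDimensional ℝ E] {ι κ : Type*} [DecidableEq ι] (v : κ → E) (w : E)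
    (hv : ∀ b, ‖v b‖ = 1) (hw : ‖w‖ = 1) (T : Finset ι) :
    ∀ (δ : ℝ) (e : ι → E), 0 ≤ δ → δ ≤ Real.pi / 2 → (∀ i, ‖e i‖ = 1) →
      (∀ i b, Real.sin δ ≤ |⟪e i, v b⟫|) → (∀ i, i ∉ T → Real.sin δ ≤ |⟪e i, w⟫|) →
      ∃ R : E ≃ₗᵢ[ℝ] E, 0 < LinearMap.det (R.toLinearEquiv.toLinearMap) ∧
        (∀ i b, Real.sin (δ * (1 / 2 : ℝ) ^ T.card) ≤ |⟪R (e i), v b⟫|) ∧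
        (∀ i, Real.sin (δ * (1 / 2 : ℝ) ^ T.card) ≤ |⟪R (e i), w⟫|) := by
  induction T using Finset.induction_on with
  | empty =>
    intro δ e _ _ _ h1 h2
    refine ⟨LinearIsometryEquiv.refl ℝ E, ?_, ?_, ?_⟩
    · have : (LinearIsometryEquiv.refl ℝ E).toLinearEquiv.toLinearMap = LinearMap.id := rfl
      rw [this, LinearMap.det_id]; exact one_pos
    · simpa using h1
    · simpa using h2
  | insert k T hk ih =>
    intro δ e h0 hpi2 he h1 h2
    have hpi := Real.pi_pos
    have hδ : δ / 2 * (1 / 2 : ℝ) ^ T.card = δ * (1 / 2 : ℝ) ^ (insert k T).card := by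
      rw [Finset.card_insert_of_notMem hk, pow_succ]; ring
    rw [← hδ]
    have hmono : Real.sin (δ / 2) ≤ Real.sin δ :=
      Real.sin_le_sin_of_le_of_le_pi_div_two (by linarith) hpi2 (by linarith)
    by_cases hkw : Real.sin (δ / 2) ≤ |⟪e k, w⟫|
    · apply ih (δ / 2) e (by linarith) (by linarith) he (fun i b => hmono.trans (h1 i b))
      intro i hi
      by_cases hik : i = k
      · rw [hik]; exact hkw
      · exact hmono.trans (h2 i (by simp [hik, hi]))
    · obtain ⟨R, hR1, hR2, hR3⟩ := exists_rot (e k) w (he k) hw (δ / 2) (by linarith)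
        (by linarith) (not_le.1 hkw)
      have hRn : ∀ i, ‖R (e i)‖ = 1 := fun i => by rw [R.norm_map, he]
      have h2δ : 2 * (δ / 2) = δ := by ring
      obtain ⟨R', hR'1, hR'2, hR'3⟩ := ih (δ / 2) (fun i => R (e i)) (by linarith) (by linarith)
        hRn
        (fun i b => perturb (e i) _ (v b) (he i) (hRn i) (hv b) _ (by linarith) (by linarith)
          (hR2 _ (he i)) (by rw [h2δ]; exact h1 i b))
        (fun i hi => by
          by_cases hik : i = k
          · rw [hik]; exact hR3
          · exact perturb (e i) _ w (he i) (hRn i) hw _ (by linarith) (by linarith)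
              (hR2 _ (he i)) (by rw [h2δ]; exact h2 i (by simp [hik, hi])))
      refine ⟨R.trans R', ?_, hR'2, hR'3⟩
      have : (R.trans R').toLinearEquiv.toLinearMap =
        R'.toLinearEquiv.toLinearMap ∘ₗ R.toLinearEquiv.toLinearMap := rfl
      rw [this, LinearMap.det_comp]
      exact mul_pos hR'1 hR1

end Aux

/-- Induction step of the angle lemma: if the orthonormal basis `{e_α}` makes angle at
least `δ ≤ arcsin(1/√n)` with the unit vectors `v_1,…,v_{ℓ−1}`, then for any further unit
vector `v_ℓ` there is a rotation `R ∈ SO(n)` such that the rotated basis `e'_α = R(e_α)`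
satisfies `|⟨e'_α, v_b⟩| ≥ sin(δ·(1/2)^{n−1})` for all `α` and all `b ∈ {1,…,ℓ}`. -/
theorem stmt_5 (n ℓ : ℕ) (hn : 2 ≤ n) (δ : ℝ) (hδ0 : 0 < δ)
    (hδ : δ ≤ Real.arcsin (1 / Real.sqrt n))
    (e : OrthonormalBasis (Fin n) ℝ (EuclideanSpace ℝ (Fin n)))
    (v : Fin (ℓ + 1) → EuclideanSpace ℝ (Fin n)) (hv : ∀ b, ‖v b‖ = 1)
    (h : ∀ (α : Fin n) (b : Fin ℓ), Real.sin δ ≤ |(⟪e α, v b.castSucc⟫)|) :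
    ∃ R : EuclideanSpace ℝ (Fin n) ≃ₗᵢ[ℝ] EuclideanSpace ℝ (Fin n),
      0 < LinearMap.det (R.toLinearEquiv.toLinearMap) ∧
      ∀ (α : Fin n) (b : Fin (ℓ + 1)),
        Real.sin (δ * (1 / 2 : ℝ) ^ (n - 1)) ≤ |(⟪R (e α), v b⟫)| := by
  have hpi := Real.pi_pos
  have hδ2 : δ ≤ Real.pi / 2 := hδ.trans (Real.arcsin_le_pi_div_two _)
  have hn0 : (0 : ℝ) < n := by exact_mod_cast (by omega : 0 < n)
  have hs0 : 0 ≤ Real.sin δ := Real.sin_nonneg_of_nonneg_of_le_pi hδ0.le (by linarith)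
  have hsin : Real.sin δ ≤ 1 / Real.sqrt n :=
    (Real.le_arcsin_iff_sin_le' ⟨by linarith, hδ2⟩).1 hδ
  have hsq : Real.sin δ ^ 2 ≤ 1 / n := by
    calc Real.sin δ ^ 2 ≤ (1 / Real.sqrt n) ^ 2 := by gcongr
      _ = 1 / (n : ℝ) := by rw [div_pow, Real.sq_sqrt hn0.le, one_pow]
  obtain ⟨k, hk⟩ : ∃ k, Real.sin δ ≤ |⟪e k, v (Fin.last ℓ)⟫| := by
    by_contra! hh
    have hsum := e.sum_sq_norm_inner_right (v (Fin.last ℓ))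
    rw [hv] at hsum
    have hlt : ∑ i, ‖⟪e i, v (Fin.last ℓ)⟫‖ ^ 2 < ∑ _i : Fin n, (1 / n : ℝ) := by
      apply Finset.sum_lt_sum_of_nonempty
      · exact ⟨⟨0, by omega⟩, Finset.mem_univ _⟩
      · intro i _
        refine lt_of_lt_of_le ?_ hsq
        rw [Real.norm_eq_abs]
        exact pow_lt_pow_left₀ (hh i) (abs_nonneg _) (by norm_num)
    rw [hsum] at hlt
    simp [hn0.ne'] at hlt
  obtain ⟨R, h1, h2, h3⟩ := main_ind (fun b : Fin ℓ => v b.castSucc) (v (Fin.last ℓ))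
    (fun b => hv _) (hv _) (Finset.univ.erase k) δ e hδ0.le hδ2 (fun i => e.norm_eq_one i) h
    (fun i hi => by
      have : i = k := by simpa using hi
      rw [this]; exact hk)
  have hcard : (Finset.univ.erase k).card = n - 1 := by
    rw [Finset.card_erase_of_mem (Finset.mem_univ _), Finset.card_univ, Fintype.card_fin]
  rw [hcard] at h2 h3
  refine ⟨R, h1, fun α b => ?_⟩
  induction b using Fin.lastCases with
  | last => exact h3 α
  | cast b => exact h2 α b
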